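/- Let Ω ⊂ ℝⁿ (n ≥ 2) be a bounded domain, T > 0, Ω_T = Ω × (0,T], ε > 0, and let Γ_{ε,T} be the parabolic ε-strip of Ω_T. Suppose u_ε satisfies the α-parabolic dynamic programming principle in Ω_T with bounded boundary data F on Γ_{ε,T}, for some 0 < α < 1. Then u_ε is bounded and sup over Ω_T of |u_ε| ≤ sup over Γ_{ε,T} of |F|. -/

import Mathlib

open MeasureTheory Metric Set
open scoped RealInnerProductSpace

noncomputable def sliceAvg (n : ℕ) (ε : ℝ) (u : EuclideanSpace ℝ (Fin n) → ℝ → ℝ)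
    (x ν : EuclideanSpace ℝ (Fin n)) (s : ℝ) : ℝ :=
  ⨍ h in {h : EuclideanSpace ℝ (Fin n) | ⟪h, ν⟫ = 0 ∧ ‖h‖ ≤ ε},
    u (x + h) s ∂(μH[(n : ℝ) - 1])

noncomputable def dppOp (n : ℕ) (α ε : ℝ) (u : EuclideanSpace ℝ (Fin n) → ℝ → ℝ)
    (x ν : EuclideanSpace ℝ (Fin n)) (s : ℝ) : ℝ :=
  α * u (x + ε • ν) s + (1 - α) * sliceAvg n ε u x ν s

noncomputable def dppMidrange (n : ℕ) (α ε : ℝ) (u : EuclideanSpace ℝ (Fin n) → ℝ → ℝ)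
    (x : EuclideanSpace ℝ (Fin n)) (s : ℝ) : ℝ :=
  (1/2) * sSup ((fun ν => dppOp n α ε u x ν s) '' sphere (0 : EuclideanSpace ℝ (Fin n)) 1)
    + (1/2) * sInf ((fun ν => dppOp n α ε u x ν s) '' sphere (0 : EuclideanSpace ℝ (Fin n)) 1)

def SatisfiesDPP (n : ℕ) (α ε : ℝ) (ΩT : Set (EuclideanSpace ℝ (Fin n) × ℝ))
    (u : EuclideanSpace ℝ (Fin n) → ℝ → ℝ) : Prop :=
  ∀ x t, (x, t) ∈ ΩT → u x t = dppMidrange n α ε u x (t - ε ^ 2 / 2)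

lemma avg_bound {X : Type*} [MeasurableSpace X] (μ : Measure X) {s : Set X} (hs : MeasurableSet s)
    (f : X → ℝ) (K : ℝ) (hK : 0 ≤ K) (h : ∀ x ∈ s, |f x| ≤ K) : |⨍ x in s, f x ∂μ| ≤ K := by
  unfold average
  set ν := (μ.restrict s) with hν
  have h1 : ∀ᵐ x ∂ν, ‖f x‖ ≤ K := by
    rw [hν]
    exact (ae_restrict_iff' hs).2 (Filter.Eventually.of_forall h)
  have h2 : ∀ᵐ x ∂((ν univ)⁻¹ • ν), ‖f x‖ ≤ K := Measure.ae_smul_measure h1 _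
  have h3 := norm_integral_le_of_norm_le_const h2
  have h4 : (((ν univ)⁻¹ • ν).real univ) ≤ 1 := by
    simp only [Measure.real, Measure.smul_apply, smul_eq_mul]
    refine ENNReal.toReal_le_of_le_ofReal zero_le_one ?_
    rw [ENNReal.ofReal_one]
    exact ENNReal.inv_mul_le_one _
  rw [Real.norm_eq_abs] at h3
  nlinarith

lemma mem_strip {E : Type*} [NormedAddCommGroup E] [NormedSpace ℝ E] {Ω : Set E} {x h : E} {ε : ℝ}
    (hx : x ∈ Ω) (hh : ‖h‖ ≤ ε) (hy : x + h ∉ Ω) : infDist (x + h) (frontier Ω) ≤ ε := by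
  have hc : IsPreconnected (segment ℝ (x + h) x) := (convex_segment _ _).isPreconnected
  obtain ⟨z, hz, hzf⟩ : ∃ z ∈ segment ℝ (x + h) x, z ∈ frontier Ω := by
    by_contra! hcon
    have hx1 : x ∈ interior Ω := by
      by_contra hi
      exact hcon x (right_mem_segment _ _ _) ⟨subset_closure hx, hi⟩
    have hy1 : x + h ∈ (closure Ω)ᶜ := by
      intro hi
      exact hcon _ (left_mem_segment _ _ _) ⟨hi, fun h' => hy (interior_subset h')⟩
    obtain ⟨w, -, hw1, hw2⟩ := hc (interior Ω) (closure Ω)ᶜ isOpen_interior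
      isClosed_closure.isOpen_compl (fun w hw => by
        by_cases hwc : w ∈ closure Ω
        · left
          by_contra hi
          exact hcon w hw ⟨hwc, hi⟩
        · exact Or.inr hwc)
      ⟨x, right_mem_segment _ _ _, hx1⟩ ⟨x + h, left_mem_segment _ _ _, hy1⟩
    exact hw2 (subset_closure (interior_subset hw1))
  refine (infDist_le_dist_of_mem hzf).trans ?_
  have := dist_add_dist_of_mem_segment hz
  have h1 : dist (x + h) x = ‖h‖ := by simp [dist_eq_norm]
  have := dist_nonneg (x := z) (y := x)
  linarith

lemma abs_mid {S : Set ℝ} {K : ℝ} (hK : 0 ≤ K) (h : ∀ y ∈ S, |y| ≤ K) :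
    |(1/2) * sSup S + (1/2) * sInf S| ≤ K := by
  rcases S.eq_empty_or_nonempty with rfl | ⟨y, hy⟩
  · simpa using hK
  have ha : BddAbove S := ⟨K, fun z hz => (abs_le.1 (h z hz)).2⟩
  have hb : BddBelow S := ⟨-K, fun z hz => (abs_le.1 (h z hz)).1⟩
  have h1 := le_csSup ha hy
  have h2 := csInf_le hb hy
  have h3 : sSup S ≤ K := csSup_le ⟨y, hy⟩ fun z hz => (abs_le.1 (h z hz)).2
  have h4 : -K ≤ sInf S := le_csInf ⟨y, hy⟩ fun z hz => (abs_le.1 (h z hz)).1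
  have h5 := abs_le.1 (h y hy)
  rw [abs_le]; constructor <;> linarith

/-- boundedness of functions satisfying the α-parabolic DPP, with
`sup_{Ω_T} |u_ε| ≤ sup_{Γ_{ε,T}} |F|`. -/
theorem stmt_0 {n : ℕ} (hn : 2 ≤ n)
    (Ω : Set (EuclideanSpace ℝ (Fin n)))
    (hΩopen : IsOpen Ω) (hΩconn : IsConnected Ω) (hΩbdd : Bornology.IsBounded Ω)
    (T ε α : ℝ) (hT : 0 < T) (hε : 0 < ε) (hα : 0 < α) (hα1 : α < 1)
    (u F : EuclideanSpace ℝ (Fin n) → ℝ → ℝ)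
    (ΩT : Set (EuclideanSpace ℝ (Fin n) × ℝ))
    (hΩT : ΩT = Ω ×ˢ Set.Ioc 0 T)
    (Γ : Set (EuclideanSpace ℝ (Fin n) × ℝ))
    (hΓ : Γ = ({x | x ∉ Ω ∧ Metric.infDist x (frontier Ω) ≤ ε} ×ˢ Set.Ioc (-(ε ^ 2 / 2)) T)
            ∪ (Ω ×ˢ Set.Ioc (-(ε ^ 2 / 2)) 0))
    (hDPP : SatisfiesDPP n α ε ΩT u)
    (hbc : ∀ p ∈ Γ, u p.1 p.2 = F p.1 p.2)
    (hFbdd : ∃ K, ∀ p ∈ Γ, |F p.1 p.2| ≤ K) :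
    (∃ K, ∀ p ∈ ΩT, |u p.1 p.2| ≤ K) ∧
      ∀ p ∈ ΩT, |u p.1 p.2| ≤ sSup ((fun q : EuclideanSpace ℝ (Fin n) × ℝ => |F q.1 q.2|) '' Γ) := by
  set K := sSup ((fun q : EuclideanSpace ℝ (Fin n) × ℝ => |F q.1 q.2|) '' Γ) with hKdef
  have hK : 0 ≤ K := Real.sSup_nonneg (by rintro _ ⟨q, _, rfl⟩; exact abs_nonneg _)
  have hΓK : ∀ p ∈ Γ, |u p.1 p.2| ≤ K := by
    intro p hp
    rw [hbc p hp]
    obtain ⟨K', hK'⟩ := hFbdd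
    exact le_csSup ⟨K', by rintro _ ⟨q, hq, rfl⟩; exact hK' q hq⟩ ⟨p, hp, rfl⟩
  have hε2 : 0 < ε ^ 2 / 2 := by positivity
  have key : ∀ k : ℕ, ∀ t, t ∈ Set.Ioc (-(ε ^ 2 / 2)) T → t ≤ k * (ε ^ 2 / 2) →
      ∀ x, (x ∈ Ω ∨ (x ∉ Ω ∧ Metric.infDist x (frontier Ω) ≤ ε)) → |u x t| ≤ K := by
    intro k
    induction k with
    | zero =>
      intro t ht htk x hx
      apply hΓK (x, t)
      rw [hΓ]
      rcases hx with hx | hx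
      · exact Or.inr ⟨hx, ht.1, by simpa using htk⟩
      · exact Or.inl ⟨hx, ht⟩
    | succ k ih =>
      intro t ht htk x hx
      by_cases hx' : x ∈ Ω
      swap
      · apply hΓK (x, t)
        rw [hΓ]
        exact Or.inl ⟨hx.resolve_left hx', ht⟩
      by_cases ht0 : t ≤ 0
      · apply hΓK (x, t)
        rw [hΓ]
        exact Or.inr ⟨hx', ht.1, ht0⟩
      push Not at ht0
      have hb : ∀ h : EuclideanSpace ℝ (Fin n), ‖h‖ ≤ ε → |u (x + h) (t - ε ^ 2 / 2)| ≤ K := by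
        intro h hh
        apply ih
        · exact ⟨by linarith, by linarith [ht.2]⟩
        · push_cast at htk; linarith
        · by_cases hy : x + h ∈ Ω
          · exact Or.inl hy
          · exact Or.inr ⟨hy, mem_strip hx' hh hy⟩
      rw [hDPP x t (by rw [hΩT]; exact ⟨hx', ht0, ht.2⟩)]
      unfold dppMidrange
      apply abs_mid hK
      rintro _ ⟨ν, hν, rfl⟩
      have hν1 : ‖ν‖ = 1 := by simpa using hν
      have h1 := hb (ε • ν) (by rw [norm_smul, hν1, Real.norm_eq_abs, abs_of_pos hε, mul_one])
      have h2 : |sliceAvg n ε u x ν (t - ε ^ 2 / 2)| ≤ K := by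
        apply avg_bound _ _ _ _ hK
        · intro h hh; exact hb h hh.2
        · apply IsClosed.measurableSet
          have c1 : IsClosed {h : EuclideanSpace ℝ (Fin n) | ⟪h, ν⟫ = 0} :=
            isClosed_eq (by fun_prop) (by fun_prop)
          have c2 : IsClosed {h : EuclideanSpace ℝ (Fin n) | ‖h‖ ≤ ε} :=
            isClosed_le (by fun_prop) (by fun_prop)
          exact c1.inter c2
      rw [abs_le] at h1 h2 ⊢
      simp only [dppOp]
      constructor <;> nlinarith
  have main : ∀ p ∈ ΩT, |u p.1 p.2| ≤ K := by
    rintro ⟨x, t⟩ hp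
    rw [hΩT] at hp
    obtain ⟨hx, ht0, htT⟩ := hp
    obtain ⟨k, hk⟩ := exists_nat_ge (t / (ε ^ 2 / 2))
    exact key k t ⟨by simp only at ht0; linarith, htT⟩ ((div_le_iff₀ hε2).1 hk) x (Or.inl hx)
  exact ⟨⟨K, main⟩, main⟩
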